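/- Let U ∈ R^{n×n}. Then U is unimodular over R if and only if U is invertible as a matrix over K and admits a Bruhat decomposition U = T·D·P·V over K (T ∈ K^{n×n} upper triangular with diagonal entries 1, V ∈ K^{n×n} lower triangular with diagonal entries 1, P a permutation matrix, D diagonal with nonzero diagonal entries u_1, …, u_n) such that Σ_{i=1}^n Deg u_i = 0. (The quantity Σ_i Deg u_i is the degree of the Dieudonné determinant, so this says U is unimodular if and only if Deg Ddet(U) = 0.) -/

import Mathlib

section CokernelLength

variable {F : Type*} [Ring F]

/-- Length is additive along maps that induce a short exact sequence of quotients. -/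
theorem length_quotient_eq_add {M M' M'' : Type*} [AddCommGroup M] [Module F M]
    [AddCommGroup M'] [Module F M'] [AddCommGroup M''] [Module F M'']
    {S : Submodule F M} {S' : Submodule F M'} {S'' : Submodule F M''}
    (i : M' →ₗ[F] M) (q : M →ₗ[F] M'') (hq : Function.Surjective q)
    (hi : ∀ x, i x ∈ S ↔ x ∈ S') (hiq : ∀ m, q m ∈ S'' ↔ ∃ x, m - i x ∈ S) :
    Module.length F (M ⧸ S) = Module.length F (M' ⧸ S') + Module.length F (M'' ⧸ S'') := by
  have hle : S ≤ S''.comap q := fun m hm => (hiq m).2 ⟨0, by simpa using hm⟩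
  refine Module.length_eq_add_of_exact (S'.mapQ S i fun x hx => (hi x).2 hx) (S.mapQ S'' q hle)
    ?_ ?_ ?_
  · rw [← LinearMap.ker_eq_bot, LinearMap.ker_eq_bot']
    intro x
    obtain ⟨x, rfl⟩ := S'.mkQ_surjective x
    simp [hi]
  · intro y
    obtain ⟨m, rfl⟩ := S''.mkQ_surjective y
    obtain ⟨m, rfl⟩ := hq m
    exact ⟨S.mkQ m, rfl⟩
  · intro m
    obtain ⟨m, rfl⟩ := S.mkQ_surjective m
    simp only [Submodule.mkQ_apply, Submodule.mapQ_apply, Submodule.Quotient.mk_eq_zero, hiq]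
    constructor
    · rintro ⟨x, hx⟩
      exact ⟨S'.mkQ x, ((Submodule.Quotient.eq S).2 hx).symm⟩
    · rintro ⟨x, hx⟩
      obtain ⟨x, rfl⟩ := S'.mkQ_surjective x
      exact ⟨x, (Submodule.Quotient.eq S).1 hx.symm⟩

variable {M : Type*} [AddCommGroup M] [Module F M]

/-- The length of the cokernel of an endomorphism. -/
noncomputable def cokerLength (f : M →ₗ[F] M) : ℕ∞ :=
  Module.length F (M ⧸ LinearMap.range f)

theorem cokerLength_eq_zero_iff (f : M →ₗ[F] M) :
    cokerLength f = 0 ↔ Function.Surjective f := by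
  rw [cokerLength, Module.length_eq_zero_iff, Submodule.Quotient.subsingleton_iff,
    LinearMap.range_eq_top]

theorem cokerLength_comp (f g : M →ₗ[F] M) (hf : Function.Injective f) :
    cokerLength (f ∘ₗ g) = cokerLength g + cokerLength f := by
  refine length_quotient_eq_add f LinearMap.id Function.surjective_id (fun x => ?_) fun m => ?_
  · simp [hf.eq_iff]
  · constructor
    · rintro ⟨x, rfl⟩
      exact ⟨x, by simp⟩
    · rintro ⟨x, y, hy⟩
      exact ⟨x + g y, by simpa [eq_sub_iff_add_eq, add_comm] using hy⟩

end CokernelLength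

section MatrixLength

variable {R : Type*} [Ring R] (F : Subring R)

/-- The length over `F` of `R / R g`. -/
noncomputable def elemLength (g : R) : ℕ∞ := cokerLength (LinearMap.mulRight F g)

/-- Right multiplication by a square matrix on row vectors, as an `F`-linear map. -/
def rowMap {n : ℕ} (A : Matrix (Fin n) (Fin n) R) : (Fin n → R) →ₗ[F] (Fin n → R) :=
  A.vecMulLinear.restrictScalars F

@[simp]
theorem rowMap_apply {n : ℕ} (A : Matrix (Fin n) (Fin n) R) (v : Fin n → R) :
    rowMap F A v = Matrix.vecMul v A := rfl

/-- The length over `F` of the cokernel of a matrix acting on row vectors. -/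
noncomputable def rowLength {n : ℕ} (A : Matrix (Fin n) (Fin n) R) : ℕ∞ :=
  cokerLength (rowMap F A)

theorem elemLength_mul [NoZeroDivisors R] (f : R) {g : R} (hg : g ≠ 0) :
    elemLength F (f * g) = elemLength F f + elemLength F g := by
  rw [elemLength, elemLength, elemLength,
    ← cokerLength_comp _ _ fun a b h => mul_right_cancel₀ hg h]
  congr 1
  ext x
  simp [mul_assoc]

theorem elemLength_of_isUnit {g : R} (hg : IsUnit g) : elemLength F g = 0 := by
  obtain ⟨u, rfl⟩ := hg
  exact (cokerLength_eq_zero_iff _).2 fun x => ⟨x * ↑u⁻¹, by simp⟩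

theorem elemLength_pow [NoZeroDivisors R] {g : R} (hg : g ≠ 0) (k : ℕ) :
    elemLength F (g ^ k) = k * elemLength F g := by
  induction k with
  | zero => simpa using elemLength_of_isUnit F isUnit_one
  | succ k ih => rw [pow_succ, elemLength_mul F _ hg, ih]; push_cast; ring

theorem rowLength_mul {n : ℕ} (A B : Matrix (Fin n) (Fin n) R)
    (hB : Function.Injective (rowMap F B)) :
    rowLength F (A * B) = rowLength F A + rowLength F B := by
  rw [rowLength, rowLength, rowLength, ← cokerLength_comp _ _ hB]
  congr 1
  refine LinearMap.ext fun v => ?_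
  simp

/-- Splitting off a row and column `p` whose off-diagonal column entries vanish. -/
theorem rowLength_eq_add [NoZeroDivisors R] {n : ℕ} (A : Matrix (Fin (n + 1)) (Fin (n + 1)) R)
    (p : Fin (n + 1)) (hp : A p p ≠ 0) (hcol : ∀ i, A (p.succAbove i) p = 0) :
    rowLength F A =
      rowLength F (A.submatrix p.succAbove p.succAbove) + elemLength F (A p p) := by
  let i : (Fin n → R) →ₗ[F] (Fin (n + 1) → R) :=
    { toFun := fun v => p.insertNth 0 v
      map_add' := fun v w => by
        ext j; refine Fin.succAboveCases p ?_ (fun j => ?_) j <;> simp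
      map_smul' := fun a v => by
        ext j; refine Fin.succAboveCases p ?_ (fun j => ?_) j <;> simp }
  have hA (v : Fin (n + 1) → R) : Matrix.vecMul v A p = v p * A p p := by
    simp [Matrix.vecMul, dotProduct, Fin.sum_univ_succAbove _ p, hcol]
  have hi (v : Fin n → R) : i (Matrix.vecMul v (A.submatrix p.succAbove p.succAbove)) =
      Matrix.vecMul (i v) A := by
    ext j
    refine Fin.succAboveCases p ?_ (fun j => ?_) j
    · simp [hA, i]
    · simp [i, Matrix.vecMul, dotProduct, Fin.sum_univ_succAbove _ p]
  have hinj : Function.Injective i := fun v w h => by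
    ext j
    simpa [i] using congrFun h (p.succAbove j)
  have hrange (w : Fin (n + 1) → R) (hw : w p = 0) : i (fun j => w (p.succAbove j)) = w := by
    ext j; refine Fin.succAboveCases p ?_ (fun j => ?_) j <;> simp [i, hw]
  refine length_quotient_eq_add i (LinearMap.proj p) (Function.surjective_eval p)
    (fun x => ?_) fun m => ?_
  · constructor
    · rintro ⟨v, hv⟩
      have hv0 : v p = 0 := by
        have h := congrFun hv p
        simpa [hA, i, hp] using h
      refine ⟨fun j => v (p.succAbove j), hinj ?_⟩
      rw [rowMap_apply, hi, hrange v hv0]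
      exact hv
    · rintro ⟨v, rfl⟩
      exact ⟨i v, (hi v).symm⟩
  · constructor
    · rintro ⟨a, ha⟩
      let w := m - Matrix.vecMul (Pi.single p a) A
      refine ⟨fun j => w (p.succAbove j), Pi.single p a, ?_⟩
      rw [hrange w]
      · simp [w]
      · simpa [w, hA, sub_eq_zero] using ha.symm
    · rintro ⟨x, v, hv⟩
      have h := congrFun hv p
      exact ⟨v p, by simpa [hA, i] using h⟩

theorem rowLength_of_upperTriangular [NoZeroDivisors R] {n : ℕ} (A : Matrix (Fin n) (Fin n) R)
    (hA : ∀ i j, j < i → A i j = 0) (hd : ∀ i, A i i ≠ 0) :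
    rowLength F A = ∑ i, elemLength F (A i i) := by
  induction n with
  | zero => exact (cokerLength_eq_zero_iff _).2 fun x => ⟨x, Subsingleton.elim _ _⟩
  | succ n ih =>
    rw [rowLength_eq_add F A 0 (hd 0) fun i => hA _ _ (by simp),
      ih (A.submatrix _ _) (fun i j hij => hA _ _ (by simpa using hij)) fun i => hd _,
      Fin.sum_univ_succ, add_comm]
    simp

theorem rowLength_of_lowerTriangular [NoZeroDivisors R] {n : ℕ} (A : Matrix (Fin n) (Fin n) R)
    (hA : ∀ i j, i < j → A i j = 0) (hd : ∀ i, A i i ≠ 0) :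
    rowLength F A = ∑ i, elemLength F (A i i) := by
  induction n with
  | zero => exact (cokerLength_eq_zero_iff _).2 fun x => ⟨x, Subsingleton.elim _ _⟩
  | succ n ih =>
    rw [rowLength_eq_add F A (Fin.last n) (hd _) fun i => hA _ _ (by simp [Fin.castSucc_lt_last]),
      ih (A.submatrix _ _) (fun i j hij => hA _ _ (by simpa using hij)) fun i => hd _,
      Fin.sum_univ_castSucc]
    simp

theorem rowLength_scalar [NoZeroDivisors R] {n : ℕ} {r : R} (hr : r ≠ 0) :
    rowLength F (Matrix.scalar (Fin n) r) = n * elemLength F r := by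
  rw [rowLength_of_upperTriangular F _ (fun i j hij => by simp [hij.ne'])
    fun i => by simpa using hr]
  simp

theorem rowLength_eq_zero_of_mul_eq_one {n : ℕ} {A B : Matrix (Fin n) (Fin n) R}
    (h : B * A = 1) : rowLength F A = 0 :=
  (cokerLength_eq_zero_iff _).2 fun v => ⟨Matrix.vecMul v B, by simp [h]⟩

theorem exists_mul_eq_one_of_rowLength_eq_zero {n : ℕ} {A : Matrix (Fin n) (Fin n) R}
    (h : rowLength F A = 0) : ∃ B, B * A = 1 := by
  choose b hb using fun i => (cokerLength_eq_zero_iff _).1 h (Pi.single i 1)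
  refine ⟨Matrix.of b, ?_⟩
  ext i j
  rw [Matrix.mul_apply_eq_vecMul]
  exact (congrFun (hb i) j).trans (by simp [Matrix.one_apply, Pi.single_apply, eq_comm])

end MatrixLength

section Degree

variable {R : Type*} [Ring R] {degD : R → WithBot ℕ}

theorem exists_degree_eq (hbot : ∀ r : R, degD r = ⊥ ↔ r = 0) {r : R} (hr : r ≠ 0) :
    ∃ d : ℕ, degD r = d := by
  obtain ⟨d, hd⟩ := WithBot.ne_bot_iff_exists.1 (mt (hbot r).1 hr)
  exact ⟨d, hd.symm⟩

variable [Nontrivial R]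

theorem degree_one (hbot : ∀ r : R, degD r = ⊥ ↔ r = 0)
    (hmul : ∀ r s : R, degD (r * s) = degD r + degD s) : degD 1 = 0 := by
  obtain ⟨d, hd⟩ := exists_degree_eq hbot one_ne_zero
  have h := hmul 1 1
  rw [mul_one, hd] at h
  rw [hd]
  norm_cast at h ⊢
  omega

theorem degree_pow (hbot : ∀ r : R, degD r = ⊥ ↔ r = 0)
    (hmul : ∀ r s : R, degD (r * s) = degD r + degD s) (r : R) (k : ℕ) :
    degD (r ^ k) = k • degD r := by
  induction k with
  | zero => simpa using degree_one hbot hmul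
  | succ k ih => rw [pow_succ, hmul, ih, succ_nsmul]

/-- The subring of elements of degree at most zero. -/
def degSubring (hbot : ∀ r : R, degD r = ⊥ ↔ r = 0)
    (hmul : ∀ r s : R, degD (r * s) = degD r + degD s)
    (hadd : ∀ r s : R, degD (r + s) ≤ max (degD r) (degD s)) : Subring R where
  carrier := {r | degD r ≤ 0}
  one_mem' := (degree_one hbot hmul).le
  zero_mem' := by simp [(hbot 0).2 rfl]
  mul_mem' {a b} ha hb := by
    simpa [hmul] using add_le_add (Set.mem_ofPred.1 ha) (Set.mem_ofPred.1 hb)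
  add_mem' {a b} ha hb := (hadd a b).trans (max_le ha hb)
  neg_mem' {a} ha := by
    have h : degD (-1) = 0 := by
      obtain ⟨d, hd⟩ := exists_degree_eq hbot (r := (-1 : R)) (by simp)
      have h := hmul (-1) (-1)
      rw [neg_one_mul, neg_neg, degree_one hbot hmul, hd] at h
      rw [hd]
      norm_cast at h ⊢
      omega
    rw [← neg_one_mul, Set.mem_ofPred, hmul, h, zero_add]
    exact ha

variable (hbot : ∀ r : R, degD r = ⊥ ↔ r = 0)
    (hmul : ∀ r s : R, degD (r * s) = degD r + degD s)
    (hadd : ∀ r s : R, degD (r + s) ≤ max (degD r) (degD s))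

theorem mem_degSubring {r : R} : r ∈ degSubring hbot hmul hadd ↔ degD r ≤ 0 := Iff.rfl

/-- The elements of degree less than that of `g` are representatives of `R / R g`. -/
theorem elemLength_congr
    (hdivision : ∀ f g : R, g ≠ 0 → ∃ q rem : R, f = q * g + rem ∧ degD rem < degD g)
    {f g : R} (hf : f ≠ 0) (hg : g ≠ 0) (hfg : degD f = degD g) :
    elemLength (degSubring hbot hmul hadd) f = elemLength (degSubring hbot hmul hadd) g := by
  let S : Submodule (degSubring hbot hmul hadd) R :=
    { carrier := {r | degD r < degD g}
      zero_mem' := by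
        rw [Set.mem_ofPred, (hbot 0).2 rfl, bot_lt_iff_ne_bot]
        exact mt (hbot g).1 hg
      add_mem' := fun {a b} ha hb => (hadd a b).trans_lt (max_lt ha hb)
      smul_mem' := fun a r hr => by
        rw [Set.mem_ofPred, Subring.smul_def, smul_eq_mul, hmul]
        exact (add_le_add_left a.2 _).trans_lt (by simpa using hr) }
  have key (h : R) (hh : h ≠ 0) (hd : degD h = degD g) :
      elemLength (degSubring hbot hmul hadd) h = Module.length (degSubring hbot hmul hadd) S := by
    refine (LinearEquiv.length_eq (LinearEquiv.ofBijective
      ((LinearMap.range (LinearMap.mulRight (degSubring hbot hmul hadd) h)).mkQ ∘ₗ S.subtype)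
      ⟨?_, ?_⟩)).symm
    · rw [← LinearMap.ker_eq_bot, LinearMap.ker_eq_bot']
      rintro ⟨r, hr⟩ h0
      obtain ⟨q, hq⟩ := (Submodule.Quotient.mk_eq_zero _).1 h0
      have hq' : q * h = r := hq
      have hr' : degD r < degD g := hr
      rw [← hq', hmul, hd] at hr'
      have hq0 : q = 0 := by
        by_contra hq0
        obtain ⟨a, ha⟩ := exists_degree_eq hbot hq0
        obtain ⟨b, hb⟩ := exists_degree_eq hbot hg
        rw [ha, hb] at hr'
        norm_cast at hr'
        omega
      ext
      simp [← hq', hq0]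
    · intro y
      obtain ⟨y, rfl⟩ := Submodule.mkQ_surjective _ y
      obtain ⟨q, r, hy, hr⟩ := hdivision y h hh
      refine ⟨⟨r, hr.trans_eq hd⟩, (Submodule.Quotient.eq _).2 ⟨-q, ?_⟩⟩
      simp [hy]
  rw [key f hf hfg, key g hg rfl]

/-- The length of `R / R g` is proportional to the degree of `g`. -/
theorem exists_mul_elemLength_eq_degree [NoZeroDivisors R]
    (hunit : ∀ r : R, degD r = 0 → IsUnit r)
    (hdivision : ∀ f g : R, g ≠ 0 → ∃ q rem : R, f = q * g + rem ∧ degD rem < degD g) :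
    ∃ c : ℕ, 0 < c ∧ ∀ (g : R) (d : ℕ), degD g = d →
      c * elemLength (degSubring hbot hmul hadd) g = d := by
  have hne (g : R) (d : ℕ) (hd : degD g = d) : g ≠ 0 := fun h => by
    simp [(hbot g).2 h] at hd
  by_cases hpos : ∃ c : ℕ, 0 < c ∧ ∃ p, degD p = c
  · classical
    obtain ⟨hc, p, hp⟩ := Nat.find_spec hpos
    have hmin (m : ℕ) (hm : m < Nat.find hpos) : ¬ (0 < m ∧ ∃ p, degD p = m) := Nat.find_min hpos hm
    generalize Nat.find hpos = c at *
    have hp0 := hne p c hp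
    have hone : elemLength (degSubring hbot hmul hadd) p = 1 := by
      refine Module.length_eq_one_iff.2 (isSimpleModule_iff_toSpanSingleton_surjective.2 ⟨?_, ?_⟩)
      · rw [Submodule.Quotient.nontrivial_iff, Ne, LinearMap.range_eq_top]
        intro hs
        obtain ⟨q, hq⟩ := hs 1
        have hq' : q * p = 1 := hq
        have h := hmul q p
        rw [hq', degree_one hbot hmul, hp] at h
        have hq0 : q ≠ 0 := by rintro rfl; simp at hq'
        obtain ⟨a, ha⟩ := exists_degree_eq hbot hq0
        rw [ha] at h
        norm_cast at h
        omega
      · intro x hx y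
        have hrep (x : R ⧸ LinearMap.range (LinearMap.mulRight (degSubring hbot hmul hadd) p)) :
            ∃ r : R, degD r ≤ 0 ∧ Submodule.Quotient.mk r = x := by
          obtain ⟨x, rfl⟩ := Submodule.mkQ_surjective _ x
          obtain ⟨q, r, hx, hr⟩ := hdivision x p hp0
          refine ⟨r, ?_, (Submodule.Quotient.eq _).2 ⟨-q, by simp [hx]⟩⟩
          by_contra hr0
          push Not at hr0
          obtain ⟨a, ha⟩ := exists_degree_eq hbot (r := r)
            (by rintro rfl; simp [(hbot 0).2 rfl] at hr0)
          rw [ha] at hr0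
          rw [ha, hp] at hr
          exact hmin a (by exact_mod_cast hr) ⟨by exact_mod_cast hr0, r, ha⟩
        obtain ⟨r, hr, rfl⟩ := hrep x
        obtain ⟨s, hs, rfl⟩ := hrep y
        have hr0 : r ≠ 0 := by rintro rfl; exact hx rfl
        have hrdeg : degD r = 0 := by
          obtain ⟨a, ha⟩ := exists_degree_eq hbot hr0
          rw [ha] at hr ⊢
          norm_cast at hr ⊢
          omega
        obtain ⟨u, rfl⟩ := hunit r hrdeg
        have hinv : degD (↑u⁻¹ : R) = 0 := by
          have h := hmul ↑u ↑u⁻¹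
          rwa [u.mul_inv, degree_one hbot hmul, hrdeg, zero_add, eq_comm] at h
        refine ⟨⟨s * ↑u⁻¹, ?_⟩, ?_⟩
        · rw [mem_degSubring, hmul, hinv, add_zero]
          exact hs
        · rw [LinearMap.toSpanSingleton_apply, ← Submodule.Quotient.mk_smul, Subring.smul_def]
          simp
    refine ⟨c, hc, fun g d hd => ?_⟩
    have hg0 := hne g d hd
    rw [← elemLength_pow _ hg0, elemLength_congr hbot hmul hadd hdivision
      (pow_ne_zero c hg0) (pow_ne_zero d hp0), elemLength_pow _ hp0, hone, mul_one]
    rw [degree_pow hbot hmul, degree_pow hbot hmul, hd, hp, nsmul_eq_mul, nsmul_eq_mul, mul_comm]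
  · refine ⟨1, one_pos, fun g d hd => ?_⟩
    obtain rfl : d = 0 := by
      by_contra h
      exact hpos ⟨d, Nat.pos_of_ne_zero h, g, hd⟩
    simpa using elemLength_of_isUnit _ (hunit g hd)

end Degree

section Bruhat

/-- Bruhat decomposition of an invertible matrix over a division ring, in terms of entries. -/
theorem exists_bruhat {K : Type*} [DivisionRing K] {n : ℕ} (A : Matrix (Fin n) (Fin n) K)
    (hA : ∀ x, Matrix.vecMul x A = 0 → x = 0) :
    ∃ (T V : Matrix (Fin n) (Fin n) K) (u : Fin n → K) (σ : Equiv.Perm (Fin n)),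
      (∀ i j, j < i → T i j = 0) ∧ (∀ i, T i i = 1) ∧
      (∀ i j, i < j → V i j = 0) ∧ (∀ i, V i i = 1) ∧ (∀ i, u i ≠ 0) ∧
      ∀ i j, A i j = ∑ s, T i s * u s * V (σ s) j := by
  induction n with
  | zero => exact ⟨1, 1, 1, 1, by simp⟩
  | succ n ih =>
    have hrow : ∃ k, A (Fin.last n) k ≠ 0 := by
      by_contra! h
      have h1 := congrFun (hA (Pi.single (Fin.last n) 1) (by ext j; simp [h])) (Fin.last n)
      simp at h1
    obtain ⟨k, hk, hmax⟩ : ∃ k, A (Fin.last n) k ≠ 0 ∧ ∀ j, k < j → A (Fin.last n) j = 0 := by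
      classical
      obtain ⟨k, hk, hmax⟩ := (Finset.univ.filter fun k => A (Fin.last n) k ≠ 0).exists_max_image id
        (by simpa [Finset.Nonempty] using hrow)
      refine ⟨k, by simpa using hk, fun j hj => ?_⟩
      by_contra h
      exact absurd (hmax j (by simpa using h)) (not_le.2 hj)
    let B : Matrix (Fin n) (Fin n) K := Matrix.of fun i j =>
      A i.castSucc (k.succAbove j) -
        A i.castSucc k * (A (Fin.last n) k)⁻¹ * A (Fin.last n) (k.succAbove j)
    have hB (x : Fin n → K) (hx : Matrix.vecMul x B = 0) : x = 0 := by
      have h := hA (Fin.snoc x (-∑ i, x i * (A i.castSucc k * (A (Fin.last n) k)⁻¹))) (by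
        ext j
        refine Fin.succAboveCases k ?_ (fun j => ?_) j
        · simp [Matrix.vecMul, dotProduct, Fin.sum_univ_castSucc, Finset.sum_mul, mul_assoc, hk]
        · have h := congrFun hx j
          simp only [Matrix.vecMul, dotProduct, B, Matrix.of_apply, mul_sub,
            Finset.sum_sub_distrib, Pi.zero_apply] at h
          simp [Matrix.vecMul, dotProduct, Fin.sum_univ_castSucc, Finset.sum_mul, mul_assoc,
            ← sub_eq_add_neg] at h ⊢
          exact h)
      ext i
      simpa using congrFun h i.castSucc
    obtain ⟨T, V, u, σ, hT, hT1, hV, hV1, hu, hBσ⟩ := ih B hB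
    let τ : Equiv.Perm (Fin (n + 1)) :=
      ((finSuccEquiv' (Fin.last n)).trans (Equiv.optionCongr σ)).trans (finSuccEquiv' k).symm
    have hτl : τ (Fin.last n) = k := by simp [τ]
    have hτ (i : Fin n) : τ i.castSucc = k.succAbove (σ i) := by
      rw [← Fin.succAbove_last_apply]
      simp only [τ, Equiv.trans_apply, finSuccEquiv'_succAbove]
      simp
    let T' : Matrix (Fin (n + 1)) (Fin (n + 1)) K := Matrix.of
      (Fin.snoc (fun i => Fin.snoc (T i) (A i.castSucc k * (A (Fin.last n) k)⁻¹))
        (Pi.single (Fin.last n) 1) : Fin (n + 1) → Fin (n + 1) → K)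
    let V' : Matrix (Fin (n + 1)) (Fin (n + 1)) K := Matrix.of
      (k.insertNth (fun j => (A (Fin.last n) k)⁻¹ * A (Fin.last n) j)
        (fun i => k.insertNth 0 (V i)) : Fin (n + 1) → Fin (n + 1) → K)
    refine ⟨T', V', Fin.snoc u (A (Fin.last n) k), τ, ?_, ?_, ?_, ?_, ?_, ?_⟩
    · intro i j
      refine Fin.lastCases ?_ (fun i => ?_) i <;> refine Fin.lastCases ?_ (fun j => ?_) j
      · simp
      · simp [T']
      · intro h
        exact absurd h (not_lt.2 (Fin.le_last _))
      · simpa [T'] using hT i j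
    · intro i
      refine Fin.lastCases ?_ (fun i => ?_) i
      · simp [T']
      · simpa [T'] using hT1 i
    · intro i j
      refine Fin.succAboveCases k ?_ (fun i => ?_) i
      · intro h
        simp [V', hmax j h]
      · refine Fin.succAboveCases k ?_ (fun j => ?_) j
        · simp [V']
        · simpa [V'] using hV i j
    · intro i
      refine Fin.succAboveCases k ?_ (fun i => ?_) i
      · simp [V', hk]
      · simpa [V'] using hV1 i
    · intro i
      refine Fin.lastCases ?_ (fun i => ?_) i
      · simpa using hk
      · simpa using hu i
    · intro i j
      rw [Fin.sum_univ_castSucc]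
      simp only [hτ, hτl]
      refine Fin.lastCases ?_ (fun i => ?_) i
      · simp [T', V', hk]
      · refine Fin.succAboveCases k ?_ (fun j => ?_) j
        · simp [T', V', hk]
        · have h := hBσ i j
          simp only [B, Matrix.of_apply, sub_eq_iff_eq_add] at h
          simp [T', V', hk, h, mul_assoc]

end Bruhat

section Fractions

variable {R : Type*} [Ring R] {K : Type*} [DivisionRing K]
  {φ : R →+* K}

/-- Finitely many right fractions have a common right denominator. -/
theorem exists_common_denominator [Nontrivial R] [NoZeroDivisors R]
    (hφ : Function.Injective φ)
    (hfrac : ∀ x : K, ∃ f g : R, g ≠ 0 ∧ x = φ f * (φ g)⁻¹)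
    {ι : Type*} (s : Finset ι) (x : ι → K) :
    ∃ e : R, e ≠ 0 ∧ ∀ i ∈ s, ∃ r, x i * φ e = φ r := by
  classical
  induction s using Finset.induction_on with
  | empty => exact ⟨1, one_ne_zero, by simp⟩
  | insert i s _ ih =>
    obtain ⟨e, he, hes⟩ := ih
    obtain ⟨f, g, hg, hx⟩ := hfrac (x i)
    obtain ⟨a, b, hb, hab⟩ := hfrac ((φ e)⁻¹ * φ g)
    have hφe : φ e ≠ 0 := (map_ne_zero_iff φ hφ).2 he
    have hφg : φ g ≠ 0 := (map_ne_zero_iff φ hφ).2 hg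
    have hφb : φ b ≠ 0 := (map_ne_zero_iff φ hφ).2 hb
    have hgb : g * b = e * a := hφ <| by
      rw [map_mul, map_mul, ← eq_mul_inv_iff_mul_eq₀ hφb, mul_assoc, ← hab,
        mul_inv_cancel_left₀ hφe]
    refine ⟨g * b, mul_ne_zero hg hb, fun j hj => ?_⟩
    rcases Finset.mem_insert.1 hj with rfl | hj
    · exact ⟨f * b, by rw [hx, map_mul, map_mul, mul_assoc, inv_mul_cancel_left₀ hφg]⟩
    · obtain ⟨r, hr⟩ := hes j hj
      exact ⟨r * a, by rw [hgb, map_mul, map_mul, ← mul_assoc, hr]⟩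

theorem exists_common_denominator_matrix [Nontrivial R] [NoZeroDivisors R]
    (hφ : Function.Injective φ)
    (hfrac : ∀ x : K, ∃ f g : R, g ≠ 0 ∧ x = φ f * (φ g)⁻¹)
    {n : ℕ} (A : Matrix (Fin n) (Fin n) K) :
    ∃ e : R, e ≠ 0 ∧ ∃ B : Matrix (Fin n) (Fin n) R,
      A * Matrix.scalar (Fin n) (φ e) = B.map φ := by
  obtain ⟨e, he, h⟩ := exists_common_denominator hφ hfrac Finset.univ
    fun p : Fin n × Fin n => A p.1 p.2
  choose r hr using fun p => h p (Finset.mem_univ p)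
  refine ⟨e, he, Matrix.of fun i j => r (i, j), ?_⟩
  ext i j
  simpa using hr (i, j)

theorem map_scalar {n : ℕ} (r : R) :
    (Matrix.scalar (Fin n) r).map φ = Matrix.scalar (Fin n) (φ r) := by
  ext i j
  simp [Matrix.diagonal_apply, apply_ite φ]

theorem rowMap_injective (F : Subring R) (hφ : Function.Injective φ) {n : ℕ}
    {A : Matrix (Fin n) (Fin n) R} (hA : IsUnit (A.map φ)) :
    Function.Injective (rowMap F A) := by
  rw [← LinearMap.ker_eq_bot, LinearMap.ker_eq_bot']
  intro v hv
  have h : Matrix.vecMul (φ ∘ v) (A.map φ) = 0 := by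
    ext j
    have := congrArg φ (congrFun hv j)
    simpa [Matrix.vecMul, dotProduct] using this
  obtain ⟨B, hB⟩ := hA.exists_right_inv
  have h0 : φ ∘ v = 0 := by
    rw [← Matrix.vecMul_one (φ ∘ v), ← hB, ← Matrix.vecMul_vecMul, h, Matrix.zero_vecMul]
  ext i
  exact hφ (by simpa using congrFun h0 i)

theorem isUnit_scalar {n : ℕ} {x : K} (hx : x ≠ 0) : IsUnit (Matrix.scalar (Fin n) x) :=
  (IsUnit.mk0 x hx).map (Matrix.scalar (Fin n))

/-- Additivity of cokernel lengths along a Bruhat decomposition: if `T D e` has entries `X` in `R`,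
then the length of `U` is that of `X` minus that of the scalar matrix `e`. -/
theorem rowLength_add_of_bruhat [Nontrivial R] [NoZeroDivisors R] (F : Subring R)
    (hφ : Function.Injective φ)
    (hfrac : ∀ x : K, ∃ f g : R, g ≠ 0 ∧ x = φ f * (φ g)⁻¹)
    (hfin : ∀ r : R, r ≠ 0 → elemLength F r ≠ ⊤) {n : ℕ}
    {U X : Matrix (Fin n) (Fin n) R} {S V : Matrix (Fin n) (Fin n) K} {σ : Equiv.Perm (Fin n)}
    (hU : IsUnit (U.map φ))
    (hV : ∀ i j, i < j → V i j = 0) (hV1 : ∀ i, V i i = 1)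
    (hdec : U.map φ = S * σ.permMatrix K * V) {e : R} (he : e ≠ 0)
    (hX : S * Matrix.scalar (Fin n) (φ e) = X.map φ) :
    rowLength F U + n * elemLength F e = rowLength F X := by
  have hφne {r : R} (hr : r ≠ 0) : φ r ≠ 0 := (map_ne_zero_iff φ hφ).2 hr
  have hinj {r : R} (hr : r ≠ 0) : Function.Injective (rowMap F (Matrix.scalar (Fin n) r)) :=
    rowMap_injective F hφ (by rw [map_scalar]; exact isUnit_scalar (hφne hr))
  obtain ⟨y, hy, Z, hZ⟩ := exists_common_denominator_matrix hφ hfrac V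
  obtain ⟨f, hf, W, hW⟩ := exists_common_denominator_matrix hφ hfrac
    (Matrix.scalar (Fin n) (φ e)⁻¹ * Z.map φ)
  have hVu : IsUnit V := by
    obtain ⟨B, hB⟩ := hU.exists_left_inv
    exact IsUnit.of_mul_eq_one_right (B * (S * σ.permMatrix K)) (by rw [mul_assoc, ← hdec, hB])
  have hWu : IsUnit (W.map φ) := by
    rw [← hW, ← hZ]
    exact ((isUnit_scalar (inv_ne_zero (hφne he))).mul (hVu.mul (isUnit_scalar (hφne hy)))).mul
      (isUnit_scalar (hφne hf))
  have hee : Matrix.scalar (Fin n) (φ e) * Matrix.scalar (Fin n) (φ e)⁻¹ = 1 := by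
    rw [← map_mul, mul_inv_cancel₀ (hφne he), map_one]
  have heW : Matrix.scalar (Fin n) e * W = Z * Matrix.scalar (Fin n) f := by
    refine Matrix.map_injective hφ ?_
    dsimp only
    rw [Matrix.map_mul, Matrix.map_mul, map_scalar, map_scalar, ← hW, ← mul_assoc, ← mul_assoc,
      hee, one_mul]
  have hperm : Matrix.scalar (Fin n) (φ e) * σ.permMatrix K =
      σ.permMatrix K * Matrix.scalar (Fin n) (φ e) := by
    ext i j
    simp [Equiv.Perm.permMatrix, PEquiv.toMatrix_apply]
  have hpmap : (σ.permMatrix R).map φ = σ.permMatrix K := by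
    ext i j
    simp [Equiv.Perm.permMatrix, PEquiv.toMatrix_apply, apply_ite φ]
  have hUW : U * Matrix.scalar (Fin n) y * Matrix.scalar (Fin n) f =
      X * σ.permMatrix R * W := by
    refine Matrix.map_injective hφ ?_
    simp only [Matrix.map_mul, map_scalar, hpmap]
    rw [hdec, ← hW, ← hX, ← hZ]
    calc S * σ.permMatrix K * V * Matrix.scalar (Fin n) (φ y) * Matrix.scalar (Fin n) (φ f)
        = S * σ.permMatrix K *
            (Matrix.scalar (Fin n) (φ e) * Matrix.scalar (Fin n) (φ e)⁻¹) *
            V * Matrix.scalar (Fin n) (φ y) * Matrix.scalar (Fin n) (φ f) := by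
          rw [hee, mul_one]
      _ = S * (σ.permMatrix K * Matrix.scalar (Fin n) (φ e)) * Matrix.scalar (Fin n) (φ e)⁻¹ *
            V * Matrix.scalar (Fin n) (φ y) * Matrix.scalar (Fin n) (φ f) := by
          simp only [mul_assoc]
      _ = _ := by
          rw [← hperm]
          simp only [mul_assoc]
  have hpp : σ⁻¹.permMatrix R * σ.permMatrix R = 1 := by
    rw [← Matrix.permMatrix_mul]
    simp
  have hpinj : Function.Injective (rowMap F (σ.permMatrix R)) := by
    refine rowMap_injective F hφ ?_
    rw [hpmap]
    exact IsUnit.of_mul_eq_one_right (σ⁻¹.permMatrix K) (by rw [← Matrix.permMatrix_mul]; simp)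
  have hZdiag (i : Fin n) : Z i i = y := hφ <| by
    simpa [hV1] using (congrFun (congrFun hZ i) i).symm
  have hZtri (i j : Fin n) (hij : i < j) : Z i j = 0 := hφ <| by
    simpa [hV i j hij] using (congrFun (congrFun hZ i) j).symm
  have hZlen : rowLength F Z = n * elemLength F y := by
    rw [rowLength_of_lowerTriangular F Z hZtri fun i => by rwa [hZdiag]]
    simp [hZdiag]
  have h1 := congrArg (rowLength F) hUW
  have h2 := congrArg (rowLength F) heW
  have hWinj := rowMap_injective F hφ hWu
  rw [rowLength_mul F _ _ (hinj hf), rowLength_mul F _ _ (hinj hy), rowLength_mul F _ _ hWinj,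
    rowLength_mul F _ _ hpinj, rowLength_eq_zero_of_mul_eq_one F hpp, rowLength_scalar F hy,
    rowLength_scalar F hf, add_zero] at h1
  rw [rowLength_mul F _ _ hWinj, rowLength_mul F _ _ (hinj hf), rowLength_scalar F he,
    rowLength_scalar F hf, hZlen] at h2
  have hWtop : rowLength F W ≠ ⊤ := by
    refine ne_top_of_le_ne_top ?_ (le_add_self.trans_eq h2)
    exact WithTop.add_ne_top.2 ⟨WithTop.mul_ne_top (ENat.natCast_ne_top n) (hfin y hy),
      WithTop.mul_ne_top (ENat.natCast_ne_top n) (hfin f hf)⟩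
  refine ENat.add_left_injective_of_ne_top hWtop ?_
  dsimp only
  rw [add_assoc, h2, ← add_assoc, h1]

end Fractions

/-- With `R` an Ore-like ring (degree function, degree-0
elements units, right division with remainder) embedded in its division ring
of right fractions `K` via `φ`, and `Deg : K → WithBot ℤ` the extension of
the degree: a matrix `U ∈ R^{n×n}` is unimodular over `R` if and only if
`U` is invertible over `K` and admits a Bruhat decomposition
`U = T·D·P·V` over `K` whose diagonal factor `D` satisfies
`Σ_i Deg (D i i) = 0` (i.e. `Deg Ddet U = 0`). -/
theorem stmt8
    {R : Type*} [Ring R] [Nontrivial R] [NoZeroDivisors R]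
    (degD : R → WithBot ℕ)
    (hbot : ∀ r : R, degD r = ⊥ ↔ r = 0)
    (hmul : ∀ r s : R, degD (r * s) = degD r + degD s)
    (hadd : ∀ r s : R, degD (r + s) ≤ max (degD r) (degD s))
    (hunit : ∀ r : R, degD r = 0 → IsUnit r)
    (hdivision : ∀ f g : R, g ≠ 0 → ∃ q rem : R, f = q * g + rem ∧ degD rem < degD g)
    {K : Type*} [DivisionRing K]
    (φ : R →+* K) (hφ : Function.Injective φ)
    (hfrac : ∀ x : K, ∃ f g : R, g ≠ 0 ∧ x = φ f * (φ g)⁻¹)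
    (Deg : K → WithBot ℤ)
    (hDeg : ∀ f g : R, g ≠ 0 → ∀ dg : ℕ, degD g = (dg : WithBot ℕ) →
      Deg (φ f * (φ g)⁻¹) =
        (degD f).map (fun m : ℕ => (m : ℤ)) + ((-(dg : ℤ) : ℤ) : WithBot ℤ))
    {n : ℕ} (U : Matrix (Fin n) (Fin n) R) :
    (∃ V : Matrix (Fin n) (Fin n) R, U * V = 1 ∧ V * U = 1) ↔
    ((∃ W : Matrix (Fin n) (Fin n) K, U.map φ * W = 1 ∧ W * U.map φ = 1) ∧
      ∃ T D P V : Matrix (Fin n) (Fin n) K,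
        (∀ i j : Fin n, j < i → T i j = 0) ∧ (∀ i : Fin n, T i i = 1) ∧
        (∀ i j : Fin n, i < j → V i j = 0) ∧ (∀ i : Fin n, V i i = 1) ∧
        (∃ σ : Equiv.Perm (Fin n), ∀ i j : Fin n, P i j = if σ i = j then 1 else 0) ∧
        (∀ i j : Fin n, i ≠ j → D i j = 0) ∧ (∀ i : Fin n, D i i ≠ 0) ∧
        U.map φ = T * D * P * V ∧
        (∑ i : Fin n, Deg (D i i)) = 0) := by
  classical
  let F := degSubring hbot hmul hadd
  obtain ⟨c, hc, hlen⟩ := exists_mul_elemLength_eq_degree hbot hmul hadd hunit hdivision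
  have hfin (r : R) (hr : r ≠ 0) : elemLength F r ≠ ⊤ := fun h => by
    obtain ⟨d, hd⟩ := exists_degree_eq hbot hr
    have hcd := hlen r d hd
    rw [h, ENat.mul_top (by exact_mod_cast hc.ne')] at hcd
    exact ENat.natCast_ne_top d hcd.symm
  have key (hU : IsUnit (U.map φ)) {T D V : Matrix (Fin n) (Fin n) K} {σ : Equiv.Perm (Fin n)}
      (hT : ∀ i j : Fin n, j < i → T i j = 0) (hT1 : ∀ i : Fin n, T i i = 1)
      (hV : ∀ i j : Fin n, i < j → V i j = 0) (hV1 : ∀ i : Fin n, V i i = 1)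
      (hD : ∀ i j : Fin n, i ≠ j → D i j = 0) (hD0 : ∀ i : Fin n, D i i ≠ 0)
      (hdec : U.map φ = T * D * σ.permMatrix K * V) :
      (∑ i : Fin n, Deg (D i i)) = 0 ↔ rowLength F U = 0 := by
    obtain ⟨e, he, X, hX⟩ := exists_common_denominator_matrix hφ hfrac (T * D)
    have hφe : φ e ≠ 0 := (map_ne_zero_iff φ hφ).2 he
    have hDd : D = Matrix.diagonal fun i => D i i := by
      ext i j
      by_cases h : i = j
      · simp [h]
      · simp [h, hD i j h]
    have hXe (i j : Fin n) : φ (X i j) = T i j * D j j * φ e := by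
      have h := congrFun (congrFun hX i) j
      rw [hDd] at h
      simpa using h.symm
    have hX0 (i : Fin n) : X i i ≠ 0 := fun h => by
      have h0 := hXe i i
      simp [h, hT1, hD0, hφe] at h0
    have hXlen := rowLength_of_upperTriangular F X
      (fun i j hij => hφ (by simp [hXe, hT i j hij])) hX0
    have hsum := rowLength_add_of_bruhat F hφ hfrac hfin hU hV hV1 hdec he hX
    choose x hx using fun i => exists_degree_eq hbot (hX0 i)
    obtain ⟨ε, hε⟩ := exists_degree_eq hbot he
    have hDegD (i : Fin n) : Deg (D i i) = ((x i - ε : ℤ) : WithBot ℤ) := by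
      have h : D i i = φ (X i i) * (φ e)⁻¹ := by
        rw [hXe, hT1, one_mul, mul_inv_cancel_right₀ hφe]
      rw [h, hDeg _ _ he ε hε, hx]
      rfl
    have hN : c * rowLength F U + (n * ε : ℕ) = (∑ i, x i : ℕ) := by
      have h := congrArg (fun m : ℕ∞ => c * m) hsum
      simp only [hXlen, mul_add, Finset.mul_sum] at h
      rw [Finset.sum_congr rfl fun i _ => hlen (X i i) (x i) (hx i), mul_left_comm,
        hlen e ε hε] at h
      push_cast
      exact h
    have hS : (∑ i : Fin n, Deg (D i i)) = ((∑ i, (x i : ℤ) - n * ε : ℤ) : WithBot ℤ) := by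
      rw [Finset.sum_congr rfl fun i _ => hDegD i]
      have h : (∑ i, (x i : ℤ) - n * ε : ℤ) = ∑ i, (x i - ε : ℤ) := by
        simp
      rw [h, WithBot.coe_sum]
    have hzero : (∑ i : Fin n, Deg (D i i)) = 0 ↔ ∑ i, x i = n * ε := by
      rw [hS, WithBot.coe_eq_zero, sub_eq_zero]
      norm_cast
    rw [hzero]
    constructor
    · intro h
      rw [h] at hN
      have h0 : (c : ℕ∞) * rowLength F U = 0 :=
        ENat.add_left_injective_of_ne_top (ENat.natCast_ne_top (n * ε)) (by simpa using hN)
      exact (mul_eq_zero.1 h0).resolve_left (by exact_mod_cast hc.ne')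
    · intro h
      rw [h, mul_zero, zero_add] at hN
      exact_mod_cast hN.symm
  constructor
  · rintro ⟨V, hUV, hVU⟩
    have hUV' : U.map φ * V.map φ = 1 := by rw [← Matrix.map_mul, hUV]; simp
    have hVU' : V.map φ * U.map φ = 1 := by rw [← Matrix.map_mul, hVU]; simp
    refine ⟨⟨V.map φ, hUV', hVU'⟩, ?_⟩
    obtain ⟨T, L, u, σ, hT, hT1, hL, hL1, hu, hdec⟩ := exists_bruhat (U.map φ) fun x hx => by
      rw [← Matrix.vecMul_one x, ← hUV', ← Matrix.vecMul_vecMul, hx, Matrix.zero_vecMul]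
    have hdec' : U.map φ = T * Matrix.diagonal u * σ.permMatrix K * L := by
      ext i j
      rw [hdec, mul_assoc, Matrix.mul_apply]
      simp [Equiv.Perm.permMatrix, PEquiv.toMatrix_toPEquiv_mul]
    have hD (i j : Fin n) (hij : i ≠ j) : Matrix.diagonal u i j = 0 :=
      Matrix.diagonal_apply_ne _ hij
    have hD0 (i : Fin n) : Matrix.diagonal u i i ≠ 0 := by simpa using hu i
    refine ⟨T, Matrix.diagonal u, σ.permMatrix K, L, hT, hT1, hL, hL1, ⟨σ, fun i j => ?_⟩,
      hD, hD0, hdec', ?_⟩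
    · simp [Equiv.Perm.permMatrix, PEquiv.toMatrix_apply, eq_comm]
    · exact (key (IsUnit.of_mul_eq_one _ hUV') hT hT1 hL hL1 hD hD0 hdec').2
        (rowLength_eq_zero_of_mul_eq_one F hVU)
  · rintro ⟨⟨W, hUW, hWU⟩, T, D, P, L, hT, hT1, hL, hL1, ⟨σ, hP⟩, hD, hD0, hdec, hsum⟩
    obtain rfl : P = σ.permMatrix K := by
      ext i j
      simp [hP, Equiv.Perm.permMatrix, PEquiv.toMatrix_apply, eq_comm]
    obtain ⟨V, hVU⟩ := exists_mul_eq_one_of_rowLength_eq_zero F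
      ((key (IsUnit.of_mul_eq_one _ hUW) hT hT1 hL hL1 hD hD0 hdec).1 hsum)
    have : IsStablyFiniteRing R := .of_injective φ hφ
    exact ⟨V, mul_eq_one_comm.1 hVU, hVU⟩
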